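/- arXiv:2510.06117 — 7 statements merged into one kernel-verified Lean document; each statement's English description precedes it below -/
import Mathlib

section
/- Let n ≥ 1, let P be an n×n real positive definite matrix, let M be a 1×n real matrix (a row vector), let β > 0 be a real number, and let x ∈ ℝⁿ. If the (1+n)×(1+n) block matrix [[β, M], [Mᵀ, P]] is positive semidefinite and the (1+n)×(1+n) block matrix [[β, β·xᵀ], [β·x, P]] is positive semidefinite, then |M P⁻¹ x| ≤ 1 (where M P⁻¹ x denotes the scalar obtained by multiplying the row vector M, the matrix P⁻¹, and the column vector x). -/
open Matrix

/-- The Schur complement inequality for a block matrix whose upper left block is a scalar. -/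
theorem Matrix.PosDef.dotProduct_inv_mulVec_le {m : Type*} [Fintype m] [DecidableEq m]
    {P : Matrix m m ℝ} (hP : P.PosDef) {B : Matrix (Fin 1) m ℝ} {β : ℝ}
    (h : (fromBlocks (of fun _ _ => β : Matrix (Fin 1) (Fin 1) ℝ) B Bᵀ P).PosSemidef) :
    B 0 ⬝ᵥ P⁻¹ *ᵥ B 0 ≤ β := by
  have := hP.isUnit.invertible
  rw [← conjTranspose_eq_transpose_of_trivial, hP.fromBlocks₂₂] at h
  have hd : 0 ≤ β - (B * P⁻¹ * Bᴴ) 0 0 := h.diag_nonneg (i := 0)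
  rw [Matrix.mul_assoc] at hd
  exact sub_nonneg.mp hd

/-- Constraint-satisfaction step of Theorem 1: the LMIs
`[[β, M],[Mᵀ, P]] ⪰ 0` and `[[β, β xᵀ],[β x, P]] ⪰ 0` imply `|M P⁻¹ x| ≤ 1`. -/
theorem stmt0 (n : ℕ) (hn : 1 ≤ n)
    (P : Matrix (Fin n) (Fin n) ℝ) (hP : P.PosDef)
    (M : Matrix (Fin 1) (Fin n) ℝ) (β : ℝ) (hβ : 0 < β) (x : Fin n → ℝ)
    (h1 : (Matrix.fromBlocks ((Matrix.of fun _ _ => β : Matrix (Fin 1) (Fin 1) ℝ)) M Mᵀ P).PosSemidef)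
    (h2 : (Matrix.fromBlocks ((Matrix.of fun _ _ => β : Matrix (Fin 1) (Fin 1) ℝ))
            ((Matrix.of fun _ j => β * x j : Matrix (Fin 1) (Fin n) ℝ)) ((Matrix.of fun i _ => β * x i : Matrix (Fin n) (Fin 1) ℝ)) P).PosSemidef) :
    |((M * P⁻¹) *ᵥ x) 0| ≤ 1 := by
  have hm := hP.dotProduct_inv_mulVec_le h1
  have hx : (β • x) ⬝ᵥ P⁻¹ *ᵥ (β • x) ≤ β := hP.dotProduct_inv_mulVec_le h2
  have hpos (v : Fin n → ℝ) : 0 ≤ v ⬝ᵥ P⁻¹ *ᵥ v := by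
    simpa using hP.posSemidef.inv.dotProduct_mulVec_nonneg v
  have hsymm : x ⬝ᵥ P⁻¹ *ᵥ M 0 = M 0 ⬝ᵥ P⁻¹ *ᵥ x := by
    have hT : P⁻¹ᵀ = P⁻¹ := by simpa using hP.isHermitian.inv.eq
    rw [dotProduct_mulVec, ← mulVec_transpose, hT, dotProduct_comm]
  have hu : ((M * P⁻¹) *ᵥ x) 0 = M 0 ⬝ᵥ P⁻¹ *ᵥ x := by
    rw [← mulVec_mulVec]; rfl
  have hsub := hpos (M 0 - β • x)
  have hadd := hpos (M 0 + β • x)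
  simp only [mulVec_add, mulVec_sub, mulVec_smul, dotProduct_add, dotProduct_sub,
    add_dotProduct, sub_dotProduct, dotProduct_smul, smul_dotProduct, smul_eq_mul, hsymm]
    at hx hsub hadd
  rw [hu, abs_le]
  constructor <;> nlinarith
end

section
/- Let P be an n×n real positive definite matrix, let x ∈ ℝⁿ, and let β ≥ 0 be a real number. Then the matrix P − β·(x xᵀ) (where x xᵀ denotes the rank-one outer product) is positive semidefinite if and only if β · (xᵀ P⁻¹ x) ≤ 1. -/
open Matrix

/-- The quadratic form of a rank-one downdate. -/
theorem dotProduct_sub_smul_vecMulVec_mulVec {m : Type*} [Fintype m] (P : Matrix m m ℝ)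
    (x v : m → ℝ) (β : ℝ) :
    v ⬝ᵥ ((P - β • vecMulVec x x) *ᵥ v) = v ⬝ᵥ (P *ᵥ v) - β * (x ⬝ᵥ v) ^ 2 := by
  simp only [sub_mulVec, smul_mulVec, vecMulVec_mulVec, dotProduct_sub, dotProduct_smul,
    smul_eq_mul, op_smul_eq_smul, dotProduct_comm v x]
  ring

/-- Rank-one Schur-complement equivalence (content of LMI (8d)):
`P − β x xᵀ ⪰ 0 ↔ β (xᵀ P⁻¹ x) ≤ 1`. -/
theorem stmt2 (n : ℕ) (P : Matrix (Fin n) (Fin n) ℝ) (hP : P.PosDef)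
    (x : Fin n → ℝ) (β : ℝ) (hβ : 0 ≤ β) :
    (P - β • Matrix.vecMulVec x x).PosSemidef ↔ β * (x ⬝ᵥ (P⁻¹ *ᵥ x)) ≤ 1 := by
  have hPy : P *ᵥ (P⁻¹ *ᵥ x) = x := by
    rw [mulVec_mulVec, mul_nonsing_inv _ ((isUnit_iff_isUnit_det P).mp hP.isUnit), one_mulVec]
  have hq : 0 ≤ x ⬝ᵥ (P⁻¹ *ᵥ x) := by
    simpa using hP.inv.posSemidef.dotProduct_mulVec_nonneg x
  have hPT : Pᵀ = P := by simpa using hP.isHermitian.eq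
  generalize P⁻¹ *ᵥ x = y at *
  constructor
  · intro h
    have hy : 0 ≤ y ⬝ᵥ (P *ᵥ y) - β * (x ⬝ᵥ y) ^ 2 := by
      rw [← dotProduct_sub_smul_vecMulVec_mulVec]
      simpa using h.dotProduct_mulVec_nonneg y
    rw [hPy, dotProduct_comm y x] at hy
    rcases hq.eq_or_lt with h0 | hpos
    · simp [← h0]
    · by_contra! hlt
      nlinarith
  · intro h
    refine PosSemidef.of_dotProduct_mulVec_nonneg ?_ fun v => ?_
    · ext i j
      have hij : P j i = P i j := congrFun (congrFun hPT i) j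
      simp [vecMulVec_apply, hij, mul_comm (x i)]
    · rw [star_trivial, dotProduct_sub_smul_vecMulVec_mulVec]
      have hyv : y ⬝ᵥ (P *ᵥ v) = x ⬝ᵥ v := by
        rw [dotProduct_mulVec, ← mulVec_transpose, hPT, hPy]
      have hw := hP.posSemidef.dotProduct_mulVec_nonneg (v - (β * (x ⬝ᵥ v)) • y)
      simp only [star_trivial, mulVec_sub, mulVec_smul, hPy, sub_dotProduct, dotProduct_sub,
        smul_dotProduct, dotProduct_smul, smul_eq_mul, hyv, dotProduct_comm v x,
        dotProduct_comm y x] at hw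
      have hs : 0 ≤ β * (x ⬝ᵥ v) ^ 2 * (1 - β * (x ⬝ᵥ y)) :=
        mul_nonneg (mul_nonneg hβ (sq_nonneg _)) (sub_nonneg.mpr h)
      linarith
end

section
/- Let P be an n×n real positive definite matrix, A an n×n real matrix, B an n×m real matrix, M an m×n real matrix, and c > 0 a real number. Suppose the 2n×2n block matrix [[P − c·I, A P + B M], [(A P + B M)ᵀ, P]] is positive semidefinite. Let K = M P⁻¹ and A_cl = A + B K. Then for every nonzero x ∈ ℝⁿ, (A_cl x)ᵀ P⁻¹ (A_cl x) < xᵀ P⁻¹ x. -/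
open Matrix

/-- Evaluating a positive semidefinite block matrix at `(z, -w)`. -/
theorem two_mul_dotProduct_mulVec_le_of_posSemidef_fromBlocks {m n : Type*} [Fintype m] [Fintype n]
    {Q : Matrix m m ℝ} {N : Matrix m n ℝ} {P : Matrix n n ℝ}
    (h : (Matrix.fromBlocks Q N Nᵀ P).PosSemidef) (z : m → ℝ) (w : n → ℝ) :
    2 * (z ⬝ᵥ (N *ᵥ w)) ≤ z ⬝ᵥ (Q *ᵥ z) + w ⬝ᵥ (P *ᵥ w) := by
  have hzw := h.dotProduct_mulVec_nonneg (Sum.elim z (-w))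
  have hN : w ⬝ᵥ (Nᵀ *ᵥ z) = z ⬝ᵥ (N *ᵥ w) := by
    rw [mulVec_transpose, dotProduct_comm, dotProduct_mulVec]
  simp only [star_trivial, fromBlocks_mulVec, Sum.elim_comp_inl, Sum.elim_comp_inr,
    sumElim_dotProduct_sumElim, mulVec_neg, dotProduct_add, dotProduct_neg, neg_dotProduct,
    hN] at hzw
  linarith

/-- Strict Lyapunov decrease (stability part of Theorem 1): feasibility of LMI (8b)
implies `V(x) = xᵀ P⁻¹ x` strictly decreases along `x ↦ (A + B M P⁻¹) x`. -/
theorem stmt5 (n m : ℕ) (P : Matrix (Fin n) (Fin n) ℝ) (hP : P.PosDef)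
    (A : Matrix (Fin n) (Fin n) ℝ) (B : Matrix (Fin n) (Fin m) ℝ)
    (M : Matrix (Fin m) (Fin n) ℝ) (c : ℝ) (hc : 0 < c)
    (h : (Matrix.fromBlocks (P - c • (1 : Matrix (Fin n) (Fin n) ℝ)) (A * P + B * M)
      (A * P + B * M)ᵀ P).PosSemidef) :
    ∀ x : Fin n → ℝ, x ≠ 0 →
      ((A + B * (M * P⁻¹)) *ᵥ x) ⬝ᵥ (P⁻¹ *ᵥ ((A + B * (M * P⁻¹)) *ᵥ x)) <
        x ⬝ᵥ (P⁻¹ *ᵥ x) := by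
  intro x hx
  have hdet : IsUnit P.det := (isUnit_iff_isUnit_det P).mp hP.isUnit
  have hy : (A + B * (M * P⁻¹)) *ᵥ x = (A * P + B * M) *ᵥ (P⁻¹ *ᵥ x) := by
    rw [mulVec_mulVec, Matrix.add_mul, mul_nonsing_inv_cancel_right _ _ hdet, Matrix.mul_assoc]
  have hPinv (v : Fin n → ℝ) : P *ᵥ (P⁻¹ *ᵥ v) = v := by
    rw [mulVec_mulVec, mul_nonsing_inv _ hdet, one_mulVec]
  set y := (A + B * (M * P⁻¹)) *ᵥ x
  have key := two_mul_dotProduct_mulVec_le_of_posSemidef_fromBlocks h (P⁻¹ *ᵥ y) (P⁻¹ *ᵥ x)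
  rw [← hy, sub_mulVec, smul_mulVec, one_mulVec, hPinv, hPinv, dotProduct_sub, dotProduct_smul,
    smul_eq_mul, dotProduct_comm _ y, dotProduct_comm _ x] at key
  by_cases hz : P⁻¹ *ᵥ y = 0
  · rw [hz, dotProduct_zero]
    simpa using hP.inv.dotProduct_mulVec_pos hx
  · have hpos : 0 < (P⁻¹ *ᵥ y) ⬝ᵥ (P⁻¹ *ᵥ y) := by
      simpa using (PosDef.one (n := Fin n) (R := ℝ)).dotProduct_mulVec_pos hz
    linarith [mul_pos hc hpos]
end

section
/- Let A be an n×n real matrix and suppose there exist an n×n real positive definite matrix P and a real number c > 0 such that P − A P Aᵀ − c·I is positive semidefinite. Then there exist constants C₀ ≥ 0 and ρ ∈ [0, 1) such that for every x ∈ ℝⁿ and every natural number k, ‖Aᵏ x‖ ≤ C₀ · ρᵏ · ‖x‖, where ‖·‖ denotes the Euclidean norm and Aᵏ x denotes the matrix power Aᵏ applied to x. -/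
open Matrix

open scoped InnerProductSpace in
/-- A quadratic Lyapunov function decreasing by at least `c * ‖x‖ ^ 2` along `T` forces the
powers of `T` to decay geometrically. -/
theorem ContinuousLinearMap.exists_norm_pow_le_of_lyapunov {E : Type*} [NormedAddCommGroup E]
    [InnerProductSpace ℝ E] (Q T : E →L[ℝ] E) {c : ℝ} (hc : 0 < c)
    (hQ : ∀ x, 0 ≤ ⟪x, Q x⟫_ℝ)
    (hT : ∀ x, ⟪T x, Q (T x)⟫_ℝ + c * ‖x‖ ^ 2 ≤ ⟪x, Q x⟫_ℝ) :
    ∃ C : ℝ, 0 ≤ C ∧ ∃ ρ : ℝ, 0 ≤ ρ ∧ ρ < 1 ∧ ∀ k : ℕ, ‖T ^ k‖ ≤ C * ρ ^ k := by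
  set M := ‖Q‖ + c
  have hcM : c ≤ M := le_add_of_nonneg_left (norm_nonneg Q)
  have hM : 0 < M := hc.trans_le hcM
  set r := 1 - c / M with hr
  have hr0 : 0 ≤ r := sub_nonneg.2 ((div_le_one hM).2 hcM)
  have hr1 : r < 1 := sub_lt_self 1 (div_pos hc hM)
  have hupper (x : E) : ⟪x, Q x⟫_ℝ ≤ M * ‖x‖ ^ 2 := by
    have h1 := real_inner_le_norm x (Q x)
    have h2 := mul_le_mul_of_nonneg_left (Q.le_opNorm x) (norm_nonneg x)
    have h3 : 0 ≤ c * ‖x‖ ^ 2 := by positivity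
    calc ⟪x, Q x⟫_ℝ ≤ ‖x‖ * (‖Q‖ * ‖x‖) := h1.trans h2
      _ ≤ M * ‖x‖ ^ 2 := by simp only [M]; linarith
  have hlower (x : E) : c * ‖x‖ ^ 2 ≤ ⟪x, Q x⟫_ℝ := by linarith [hT x, hQ (T x)]
  have hstep (x : E) : ⟪T x, Q (T x)⟫_ℝ ≤ r * ⟪x, Q x⟫_ℝ := by
    have h : c / M * ⟪x, Q x⟫_ℝ ≤ c * ‖x‖ ^ 2 := by
      calc c / M * ⟪x, Q x⟫_ℝ ≤ c / M * (M * ‖x‖ ^ 2) := by gcongr; exact hupper x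
        _ = c * ‖x‖ ^ 2 := by field_simp
    rw [hr, sub_mul, one_mul]
    linarith [hT x]
  have hiter (x : E) (k : ℕ) : ⟪(T ^ k) x, Q ((T ^ k) x)⟫_ℝ ≤ r ^ k * ⟪x, Q x⟫_ℝ := by
    induction k with
    | zero => simp
    | succ k ih =>
      rw [pow_succ' T, pow_succ' r, mul_assoc]
      exact (hstep _).trans (mul_le_mul_of_nonneg_left ih hr0)
  refine ⟨√(M / c), Real.sqrt_nonneg _, √r, Real.sqrt_nonneg _, ?_, fun k ↦ ?_⟩
  · rwa [Real.sqrt_lt' one_pos, one_pow]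
  refine ContinuousLinearMap.opNorm_le_bound _ (by positivity) fun x ↦ ?_
  refine le_of_sq_le_sq ?_ (by positivity)
  have hsq : (√(M / c) * √r ^ k * ‖x‖) ^ 2 = M / c * r ^ k * ‖x‖ ^ 2 := by
    rw [mul_pow, mul_pow, ← pow_mul, mul_comm k, pow_mul, Real.sq_sqrt hr0,
      Real.sq_sqrt (by positivity)]
  rw [hsq]
  refine le_of_mul_le_mul_left ?_ hc
  calc c * ‖(T ^ k) x‖ ^ 2 ≤ r ^ k * ⟪x, Q x⟫_ℝ := (hlower _).trans (hiter x k)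
    _ ≤ r ^ k * (M * ‖x‖ ^ 2) := by gcongr; exact hupper x
    _ = c * (M / c * r ^ k * ‖x‖ ^ 2) := by field_simp

/-- Exponential stability (Theorem 1): a strict Stein inequality
`P − A P Aᵀ − c·I ⪰ 0` with `c > 0` yields geometric decay of trajectories
of `x_{k+1} = A x_k` in Euclidean norm. -/
theorem stmt8 (n : ℕ) (A : Matrix (Fin n) (Fin n) ℝ)
    (P : Matrix (Fin n) (Fin n) ℝ) (hP : P.PosDef) (c : ℝ) (hc : 0 < c)
    (hStein : (P - A * P * Aᵀ - c • (1 : Matrix (Fin n) (Fin n) ℝ)).PosSemidef) :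
    ∃ C₀ : ℝ, 0 ≤ C₀ ∧ ∃ ρ : ℝ, 0 ≤ ρ ∧ ρ < 1 ∧
      ∀ (x : EuclideanSpace ℝ (Fin n)) (k : ℕ),
        ‖Matrix.toEuclideanLin (A ^ k) x‖ ≤ C₀ * ρ ^ k * ‖x‖ := by
  obtain ⟨C, hC, ρ, hρ0, hρ1, h⟩ :=
    ContinuousLinearMap.exists_norm_pow_le_of_lyapunov
      (toEuclideanCLM (n := Fin n) (𝕜 := ℝ) P) (toEuclideanCLM (n := Fin n) (𝕜 := ℝ) (star A)) hc
      (fun x ↦ by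
        rw [inner_toEuclideanCLM]
        simpa using hP.posSemidef.dotProduct_mulVec_nonneg x.ofLp)
      (fun x ↦ by
        have hx := hStein.dotProduct_mulVec_nonneg x.ofLp
        simp only [inner_toEuclideanCLM, ofLp_toEuclideanCLM, EuclideanSpace.real_norm_sq_eq]
        simp only [sub_mulVec, smul_mulVec, one_mulVec, dotProduct_sub, dotProduct_smul,
          star_trivial, smul_eq_mul, ← mulVec_mulVec] at hx
        rw [dotProduct_mulVec _ A, ← mulVec_transpose] at hx
        simp only [star_eq_conjTranspose, conjTranspose_eq_transpose_of_trivial]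
        have hs : x.ofLp ⬝ᵥ x.ofLp = ∑ i, x.ofLp i ^ 2 := by simp [dotProduct, sq]
        rw [← hs]
        linarith)
  refine ⟨C, hC, ρ, hρ0, hρ1, fun x k ↦ ?_⟩
  rw [← coe_toEuclideanCLM_eq_toEuclideanLin]
  refine (ContinuousLinearMap.le_opNorm _ x).trans ?_
  gcongr
  rw [← norm_star, ← map_star, star_pow, map_pow]
  exact h k
end

section
/- Let P be an n×n real positive definite matrix, A an n×n real matrix, B an n×m real matrix, M an m×n real matrix, β > 0 and c > 0 real numbers, and x ∈ ℝⁿ. Suppose the block matrix [[β, β·xᵀ], [β·x, P]] is positive semidefinite and the block matrix [[P − c·I, A P + B M], [(A P + B M)ᵀ, P]] is positive semidefinite. Let x₊ = (A + B M P⁻¹) x. Then the block matrix [[β, β·x₊ᵀ], [β·x₊, P]] is positive semidefinite. -/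
open Matrix

/-- Schur complement criterion for a bordered matrix with a positive scalar corner. -/
lemma posSemidef_fromBlocks_smul_iff {n : Type*} [Finite n]
    (P : Matrix n n ℝ) {β : ℝ} (hβ : 0 < β) (x : n → ℝ) :
    (Matrix.fromBlocks (Matrix.of fun _ _ => β : Matrix (Fin 1) (Fin 1) ℝ)
      (Matrix.of fun _ j => β * x j : Matrix (Fin 1) n ℝ)
      (Matrix.of fun i _ => β * x i : Matrix n (Fin 1) ℝ) P).PosSemidef ↔
    (P - β • vecMulVec x x).PosSemidef := by
  have hcorner : (Matrix.of fun _ _ => β : Matrix (Fin 1) (Fin 1) ℝ) = diagonal fun _ => β := by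
    ext i j
    simp [Subsingleton.elim i j]
  have hpos : (diagonal fun _ => β : Matrix (Fin 1) (Fin 1) ℝ).PosDef :=
    PosDef.diagonal fun _ => hβ
  have := hpos.isUnit.invertible
  have hcol : (Matrix.of fun i _ => β * x i : Matrix n (Fin 1) ℝ) =
      (Matrix.of fun _ j => β * x j : Matrix (Fin 1) n ℝ)ᴴ := by
    ext i j
    simp
  have hinv : (diagonal fun _ => β : Matrix (Fin 1) (Fin 1) ℝ)⁻¹ = diagonal fun _ => β⁻¹ := by
    apply inv_eq_left_inv
    simp [hβ.ne']
  rw [hcorner, hcol, PosDef.fromBlocks₁₁ _ _ hpos, hinv]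
  congr! 2
  ext i j
  simp [Matrix.mul_apply, vecMulVec_apply]
  field_simp

/-- Recursive feasibility (proof of Theorem 1): if LMIs (8d) and (8b) hold at `x`,
then (8d) also holds at the next closed-loop state `x₊ = (A + B M P⁻¹) x`. -/
theorem stmt9 (n m : ℕ) (P : Matrix (Fin n) (Fin n) ℝ) (hP : P.PosDef)
    (A : Matrix (Fin n) (Fin n) ℝ) (B : Matrix (Fin n) (Fin m) ℝ)
    (M : Matrix (Fin m) (Fin n) ℝ) (β c : ℝ) (hβ : 0 < β) (hc : 0 < c)
    (x : Fin n → ℝ)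
    (h1 : (Matrix.fromBlocks ((Matrix.of fun _ _ => β : Matrix (Fin 1) (Fin 1) ℝ))
            ((Matrix.of fun _ j => β * x j : Matrix (Fin 1) (Fin n) ℝ))
            ((Matrix.of fun i _ => β * x i : Matrix (Fin n) (Fin 1) ℝ)) P).PosSemidef)
    (h2 : (Matrix.fromBlocks (P - c • (1 : Matrix (Fin n) (Fin n) ℝ)) (A * P + B * M)
            (A * P + B * M)ᵀ P).PosSemidef) :
    (Matrix.fromBlocks ((Matrix.of fun _ _ => β : Matrix (Fin 1) (Fin 1) ℝ))
      ((Matrix.of fun _ j => β * ((A + B * (M * P⁻¹)) *ᵥ x) j : Matrix (Fin 1) (Fin n) ℝ))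
      ((Matrix.of fun i _ => β * ((A + B * (M * P⁻¹)) *ᵥ x) i : Matrix (Fin n) (Fin 1) ℝ))
      P).PosSemidef := by
  rw [posSemidef_fromBlocks_smul_iff P hβ] at h1 ⊢
  have := hP.isUnit.invertible
  set K := A + B * (M * P⁻¹) with hK
  have hKP : A * P + B * M = K * P := by
    simp [hK, Matrix.add_mul, Matrix.mul_assoc]
  rw [hKP, ← conjTranspose_eq_transpose_of_trivial, PosDef.fromBlocks₂₂ _ _ hP] at h2
  have hKPK : K * P * P⁻¹ * (K * P)ᴴ = K * P * Kᴴ := by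
    rw [conjTranspose_mul, hP.isHermitian.eq, Matrix.mul_inv_cancel_right_of_invertible,
      Matrix.mul_assoc]
  rw [hKPK] at h2
  have hconj := h1.mul_mul_conjTranspose_same K
  have hcI : (c • (1 : Matrix (Fin n) (Fin n) ℝ)).PosSemidef := PosSemidef.one.smul hc.le
  have hrank : K * vecMulVec x x * Kᴴ = vecMulVec (K *ᵥ x) (K *ᵥ x) := by
    rw [mul_vecMulVec, vecMulVec_mul, conjTranspose_eq_transpose_of_trivial, vecMul_transpose]
  have hsum : P - β • vecMulVec (K *ᵥ x) (K *ᵥ x) =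
      (P - c • 1 - K * P * Kᴴ) + K * (P - β • vecMulVec x x) * Kᴴ + c • 1 := by
    rw [Matrix.mul_sub, Matrix.sub_mul, Matrix.mul_smul, Matrix.smul_mul, hrank]
    abel
  rw [hsum]
  exact (h2.add hconj).add hcI
end

section
/- Let P and P' be n×n real positive definite matrices with P' − P positive semidefinite, let A be an n×n real matrix, B an n×m real matrix, M an m×n real matrix, and c > 0 a real number. Suppose the block matrix [[P − c·I, A P + B M], [(A P + B M)ᵀ, P]] is positive semidefinite. Let x ∈ ℝⁿ be nonzero and let x₊ = (A + B M P⁻¹) x. Then x₊ᵀ P'⁻¹ x₊ < xᵀ P⁻¹ x. -/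
open Matrix

/-- Inequality chain (10) in the proof of Theorem 1: with `P' ⪰ P ≻ 0` and
LMI (8b) feasible for `P`, the Lyapunov value strictly decreases:
`x₊ᵀ P'⁻¹ x₊ < xᵀ P⁻¹ x` where `x₊ = (A + B M P⁻¹) x`. -/
theorem stmt11 (n m : ℕ) (P P' : Matrix (Fin n) (Fin n) ℝ)
    (hP : P.PosDef) (hP' : P'.PosDef) (hmono : (P' - P).PosSemidef)
    (A : Matrix (Fin n) (Fin n) ℝ) (B : Matrix (Fin n) (Fin m) ℝ)
    (M : Matrix (Fin m) (Fin n) ℝ) (c : ℝ) (hc : 0 < c)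
    (h : (Matrix.fromBlocks (P - c • (1 : Matrix (Fin n) (Fin n) ℝ)) (A * P + B * M)
      (A * P + B * M)ᵀ P).PosSemidef)
    (x : Fin n → ℝ) (hx : x ≠ 0) :
    ((A + B * (M * P⁻¹)) *ᵥ x) ⬝ᵥ (P'⁻¹ *ᵥ ((A + B * (M * P⁻¹)) *ᵥ x)) <
      x ⬝ᵥ (P⁻¹ *ᵥ x) := by
  have hPdet : IsUnit P.det := (Matrix.isUnit_iff_isUnit_det P).mp hP.isUnit
  have hP'det : IsUnit P'.det := (Matrix.isUnit_iff_isUnit_det P').mp hP'.isUnit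
  set y := (A + B * (M * P⁻¹)) *ᵥ x with hy
  set w := P⁻¹ *ᵥ x with hw
  set z := P'⁻¹ *ᵥ y with hz
  have hPw : P *ᵥ w = x := by
    rw [hw, mulVec_mulVec, mul_nonsing_inv _ hPdet, one_mulVec]
  have hP'z : P' *ᵥ z = y := by
    rw [hz, mulVec_mulVec, mul_nonsing_inv _ hP'det, one_mulVec]
  have hKw : (A * P + B * M) *ᵥ w = y := by
    rw [hy, hw, mulVec_mulVec, Matrix.add_mul, Matrix.mul_assoc A, mul_nonsing_inv _ hPdet,
      Matrix.mul_one, Matrix.mul_assoc]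
  have hblock := h.dotProduct_mulVec_nonneg (Sum.elim z (-w))
  have hPz := hmono.dotProduct_mulVec_nonneg z
  have hxw : 0 < x ⬝ᵥ w := by simpa using hP.inv.dotProduct_mulVec_pos hx
  have hzK : w ⬝ᵥ ((A * P + B * M)ᵀ *ᵥ z) = y ⬝ᵥ z := by
    rw [mulVec_transpose, dotProduct_comm, ← dotProduct_mulVec, hKw, dotProduct_comm]
  rw [star_trivial, sub_mulVec, dotProduct_sub, hP'z, dotProduct_comm z y] at hPz
  rw [star_trivial, fromBlocks_mulVec, sumElim_dotProduct_sumElim] at hblock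
  simp only [Sum.elim_comp_inl, Sum.elim_comp_inr, mulVec_neg, hKw, hPw, sub_mulVec, smul_mulVec,
    one_mulVec, dotProduct_add, dotProduct_sub, dotProduct_neg, neg_dotProduct, dotProduct_smul,
    smul_eq_mul, hzK, dotProduct_comm z y, dotProduct_comm w x] at hblock
  rcases eq_or_ne z 0 with hz0 | hz0
  · simpa [hz0] using hxw
  · have hzz : 0 < z ⬝ᵥ z := by simpa using dotProduct_star_self_pos_iff.mpr hz0
    nlinarith [mul_pos hc hzz]
end

section
/- Let A be an n×n real matrix, B an n×1 real matrix, and ε ≥ 0. Let N be a natural number and suppose given data samples (x_k, u_k, y_k) ∈ ℝⁿ × ℝ × ℝⁿ for k = 0, …, N−1 such that for every k, every entry of y_k − (A x_k + u_k·B) has absolute value at most ε. Define the consistency set 𝒞 as the set of pairs (A', B') of an n×n real matrix and an n×1 real matrix such that for every k, every entry of y_k − (A' x_k + u_k·B') has absolute value at most ε. Let P be an n×n real positive definite matrix, M a 1×n real matrix, β > 0 and c > 0 real numbers, and x ∈ ℝⁿ, and suppose that for every (A', B') ∈ 𝒞, the block matrix [[P − c·I, A' P + B' M], [(A' P + B'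 M)ᵀ, P]] is positive semidefinite, the block matrix [[β, M], [Mᵀ, P]] is positive semidefinite, and the block matrix [[β, β·xᵀ], [β·x, P]] is positive semidefinite. Then: (i) |M P⁻¹ x| ≤ 1; and (ii) for every nonzero y ∈ ℝⁿ, ((A + B M P⁻¹) y)ᵀ P⁻¹ ((A + B M P⁻¹) y) < yᵀ P⁻¹ y. -/
open Matrix

/-- The quadratic form of a real positive semidefinite block matrix is nonnegative. -/
theorem posSemidef_fromBlocks_quadForm_nonneg {m n : Type*} [Fintype m] [Fintype n]
    {Q : Matrix m m ℝ} {L : Matrix m n ℝ} {P : Matrix n n ℝ}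
    (h : (fromBlocks Q L Lᵀ P).PosSemidef) (a : m → ℝ) (b : n → ℝ) :
    0 ≤ a ⬝ᵥ (Q *ᵥ a) + 2 * (a ⬝ᵥ (L *ᵥ b)) + b ⬝ᵥ (P *ᵥ b) := by
  have h0 := h.dotProduct_mulVec_nonneg (Sum.elim a b)
  have h1 : b ⬝ᵥ (Lᵀ *ᵥ a) = a ⬝ᵥ (L *ᵥ b) := by
    rw [mulVec_transpose, dotProduct_comm, dotProduct_mulVec]
  rw [star_trivial, fromBlocks_mulVec, sumElim_dotProduct_sumElim, Sum.elim_comp_inl,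
    Sum.elim_comp_inr, dotProduct_add, dotProduct_add, h1] at h0
  linarith

/-- A linear matrix inequality with margin `c` makes `w ↦ L w` a strict contraction from the
`P`-energy to the `P⁻¹`-energy. -/
theorem dotProduct_inv_mulVec_lt_of_posSemidef_fromBlocks {n : Type*} [Fintype n] [DecidableEq n]
    {P L : Matrix n n ℝ} (hP : P.PosDef) {c : ℝ} (hc : 0 < c)
    (h : (fromBlocks (P - c • (1 : Matrix n n ℝ)) L Lᵀ P).PosSemidef)
    {w : n → ℝ} (hw : w ≠ 0) :
    (L *ᵥ w) ⬝ᵥ (P⁻¹ *ᵥ (L *ᵥ w)) < w ⬝ᵥ (P *ᵥ w) := by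
  have hwP : 0 < w ⬝ᵥ (P *ᵥ w) := hP.dotProduct_mulVec_pos hw
  have hcancel : P *ᵥ (P⁻¹ *ᵥ (L *ᵥ w)) = L *ᵥ w := by
    rw [mulVec_mulVec, mul_nonsing_inv _ ((isUnit_iff_isUnit_det P).mp hP.isUnit), one_mulVec]
  set z := L *ᵥ w
  set a := P⁻¹ *ᵥ z
  by_cases ha : a = 0
  · simpa [ha] using hwP
  have h0 := posSemidef_fromBlocks_quadForm_nonneg h (-a) w
  rw [sub_mulVec, smul_mulVec, one_mulVec, mulVec_neg, hcancel] at h0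
  simp only [neg_dotProduct, dotProduct_sub, dotProduct_neg, dotProduct_smul, smul_eq_mul] at h0
  have haa : 0 < a ⬝ᵥ a := by simpa using dotProduct_star_self_pos_iff.mpr ha
  rw [dotProduct_comm z a]
  linarith [mul_pos hc haa]

/-- Ellipsoidal input bound: if `x` lies in the ellipsoid `xᵀ P⁻¹ x ≤ 1 / β` and `M P⁻¹ Mᵀ ≤ β`,
both stated as linear matrix inequalities, then `|M P⁻¹ x| ≤ 1`. -/
theorem abs_mul_inv_mulVec_le_one {n : Type*} [Fintype n] [DecidableEq n]
    {P : Matrix n n ℝ} (hP : P.PosDef) {M : Matrix (Fin 1) n ℝ} {β : ℝ} (hβ : 0 < β) {x : n → ℝ}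
    (hM : (fromBlocks (of fun _ _ => β : Matrix (Fin 1) (Fin 1) ℝ) M Mᵀ P).PosSemidef)
    (hx : (fromBlocks (of fun _ _ => β : Matrix (Fin 1) (Fin 1) ℝ)
      (of fun _ j => β * x j : Matrix (Fin 1) n ℝ)
      (of fun i _ => β * x i : Matrix n (Fin 1) ℝ) P).PosSemidef) :
    |((M * P⁻¹) *ᵥ x) 0| ≤ 1 := by
  have hcancel : P *ᵥ (P⁻¹ *ᵥ x) = x := by
    rw [mulVec_mulVec, mul_nonsing_inv _ ((isUnit_iff_isUnit_det P).mp hP.isUnit), one_mulVec]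
  rw [← mulVec_mulVec]
  set w := P⁻¹ *ᵥ x
  set s := (M *ᵥ w) 0 with hs
  set q := x ⬝ᵥ w with hq
  have hqP : w ⬝ᵥ (P *ᵥ w) = q := by rw [hcancel, dotProduct_comm]
  have hrow : (of fun _ j => β * x j : Matrix (Fin 1) n ℝ) *ᵥ w = fun _ => β * q := by
    ext i
    simp [mulVec, dotProduct, hq, Finset.mul_sum, mul_assoc]
  have h1 := posSemidef_fromBlocks_quadForm_nonneg hM (fun _ => -(s / β)) w
  have h2 := posSemidef_fromBlocks_quadForm_nonneg
    (L := (of fun _ j => β * x j : Matrix (Fin 1) n ℝ)) hx (fun _ => -q) w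
  rw [hqP] at h1 h2
  rw [hrow] at h2
  simp only [dotProduct, mulVec, of_apply, Fin.sum_univ_one] at h1 h2
  change 0 ≤ -(s / β) * (β * -(s / β)) + 2 * (-(s / β) * s) + q at h1
  have hsq : s ^ 2 ≤ β * q := by
    have h3 := mul_nonneg hβ.le h1
    have h4 : β * (-(s / β) * (β * -(s / β)) + 2 * (-(s / β) * s) + q) = β * q - s ^ 2 := by
      field_simp
      ring
    linarith
  have hβq : β * q ≤ 1 := by
    by_contra! hlt
    have hq0 : 0 < q := pos_of_mul_pos_right (one_pos.trans hlt) hβ.le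
    nlinarith
  exact (sq_le_one_iff_abs_le_one s).mp (hsq.trans hβq)

/-- Core of Theorem 3: a controller `u = M P⁻¹ x` whose LMIs hold robustly over
the consistency set `𝒞` of all systems `(A', B')` compatible with the noisy data
satisfies the input constraint `|u| ≤ 1` and strictly decreases the Lyapunov
function `V(y) = yᵀ P⁻¹ y` for the unknown true system `(A, B)`. -/
theorem stmt12 (n : ℕ) (A : Matrix (Fin n) (Fin n) ℝ) (B : Matrix (Fin n) (Fin 1) ℝ)
    (ε : ℝ) (hε : 0 ≤ ε) (N : ℕ)
    (xd : Fin N → Fin n → ℝ) (ud : Fin N → ℝ) (yd : Fin N → Fin n → ℝ)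
    (hdata : ∀ k : Fin N, ∀ i : Fin n,
      |yd k i - (A *ᵥ xd k + ud k • (fun i' => B i' 0)) i| ≤ ε)
    (P : Matrix (Fin n) (Fin n) ℝ) (hP : P.PosDef)
    (M : Matrix (Fin 1) (Fin n) ℝ) (β c : ℝ) (hβ : 0 < β) (hc : 0 < c)
    (x : Fin n → ℝ)
    (hrobust : ∀ (A' : Matrix (Fin n) (Fin n) ℝ) (B' : Matrix (Fin n) (Fin 1) ℝ),
      (∀ k : Fin N, ∀ i : Fin n,
        |yd k i - (A' *ᵥ xd k + ud k • (fun i' => B' i' 0)) i| ≤ ε) →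
      (Matrix.fromBlocks (P - c • (1 : Matrix (Fin n) (Fin n) ℝ)) (A' * P + B' * M)
        (A' * P + B' * M)ᵀ P).PosSemidef ∧
      (Matrix.fromBlocks ((Matrix.of fun _ _ => β : Matrix (Fin 1) (Fin 1) ℝ)) M
        Mᵀ P).PosSemidef ∧
      (Matrix.fromBlocks ((Matrix.of fun _ _ => β : Matrix (Fin 1) (Fin 1) ℝ))
        ((Matrix.of fun _ j => β * x j : Matrix (Fin 1) (Fin n) ℝ))
        ((Matrix.of fun i _ => β * x i : Matrix (Fin n) (Fin 1) ℝ)) P).PosSemidef) :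
    |((M * P⁻¹) *ᵥ x) 0| ≤ 1 ∧
    ∀ y : Fin n → ℝ, y ≠ 0 →
      ((A + B * (M * P⁻¹)) *ᵥ y) ⬝ᵥ (P⁻¹ *ᵥ ((A + B * (M * P⁻¹)) *ᵥ y)) <
        y ⬝ᵥ (P⁻¹ *ᵥ y) := by
  obtain ⟨hL, hM, hx⟩ := hrobust A B hdata
  refine ⟨abs_mul_inv_mulVec_le_one hP hβ hM hx, fun y hy => ?_⟩
  have hdet : IsUnit P.det := (isUnit_iff_isUnit_det P).mp hP.isUnit
  have hcancel : P *ᵥ (P⁻¹ *ᵥ y) = y := by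
    rw [mulVec_mulVec, mul_nonsing_inv _ hdet, one_mulVec]
  have hw : P⁻¹ *ᵥ y ≠ 0 := fun h => hy (by rw [← hcancel, h, mulVec_zero])
  have hclosed : (A + B * (M * P⁻¹)) *ᵥ y = (A * P + B * M) *ᵥ (P⁻¹ *ᵥ y) := by
    rw [mulVec_mulVec, Matrix.add_mul, mul_nonsing_inv_cancel_right _ _ hdet, Matrix.mul_assoc]
  have hlt := dotProduct_inv_mulVec_lt_of_posSemidef_fromBlocks hP hc hL hw
  rwa [hcancel, dotProduct_comm _ y, ← hclosed] at hlt
end
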